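/- arXiv:1603.07316 — 2 statements merged into one kernel-verified Lean document; each statement's English description precedes it below -/
import Mathlib

section
/- Let n₁,n₂ ≥ 2, 1 ≤ s₁ ≤ n₁, 1 ≤ s₂ ≤ n₂. Then the dimension of the set Δ(M¹_{s₁,s₂}(n₁,n₂)) ⊆ M(n₁,n₂) ≅ ℂ^{n₁n₂} equals 2(n₁+n₂−2) if s₁ = n₁ and s₂ = n₂, and equals 2(s₁+s₂−1) in all other cases. -/
noncomputable section

/-- A vector in `ℂⁿ` is `s`-sparse if it has at most `s` nonzero entries. -/
def Sparse {n : ℕ} (s : ℕ) (u : Fin n → ℂ) : Prop := {i | u i ≠ 0}.ncard ≤ s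

/-- `M¹_{s₁,s₂}(n₁,n₂)`: matrices of the form `u vᵗ` with `u` `s₁`-sparse and `v` `s₂`-sparse. -/
def M1 (n₁ n₂ s₁ s₂ : ℕ) : Set (Matrix (Fin n₁) (Fin n₂) ℂ) :=
  {X | ∃ u : Fin n₁ → ℂ, ∃ v : Fin n₂ → ℂ,
    Sparse s₁ u ∧ Sparse s₂ v ∧ X = Matrix.vecMulVec u v}

/-- `Δ(S) = {X - Y : X, Y ∈ S}`. -/
def diffSet {n₁ n₂ : ℕ} (S : Set (Matrix (Fin n₁) (Fin n₂) ℂ)) :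
    Set (Matrix (Fin n₁) (Fin n₂) ℂ) :=
  {Z | ∃ X ∈ S, ∃ Y ∈ S, Z = X - Y}

/-- Frobenius norm of a complex matrix. -/
def frob {a b : ℕ} (X : Matrix (Fin a) (Fin b) ℂ) : ℝ :=
  Real.sqrt (∑ i, ∑ j, ‖X i j‖ ^ 2)

/-- Euclidean norm of a vector in `ℂ^m`. -/
def l2 {m : ℕ} (v : Fin m → ℂ) : ℝ := Real.sqrt (∑ i, ‖v i‖ ^ 2)

/-- A (linear) map `M : M(n₁,n₂) → ℂ^m` is stably `(s₁,s₂)`-injective if there is `C > 0` with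
`‖M(X)‖₂ ≥ C ‖X‖_F` for all `X ∈ Δ(M¹_{s₁,s₂}(n₁,n₂))`. -/
def StablyInj (n₁ n₂ s₁ s₂ m : ℕ) (M : Matrix (Fin n₁) (Fin n₂) ℂ → (Fin m → ℂ)) : Prop :=
  ∃ C : ℝ, 0 < C ∧ ∀ X ∈ diffSet (M1 n₁ n₂ s₁ s₂), C * frob X ≤ l2 (M X)

/-- The Zariski topology on `M(n₁,n₂) ≅ ℂ^{n₁n₂}`: closed sets are common zero loci of
families of complex polynomials in the matrix entries. -/
def zarMat (n₁ n₂ : ℕ) : TopologicalSpace (Matrix (Fin n₁) (Fin n₂) ℂ) :=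
  TopologicalSpace.generateFrom
    {U | ∃ p : MvPolynomial (Fin n₁ × Fin n₂) ℂ,
      U = {X | MvPolynomial.eval (fun q => X q.1 q.2) p ≠ 0}}


open TopologicalSpace Order

attribute [local instance] zarMat

/-- evaluation of a polynomial at a matrix -/
def pev {a b : ℕ} (X : Matrix (Fin a) (Fin b) ℂ) (p : MvPolynomial (Fin a × Fin b) ℂ) : ℂ :=
  MvPolynomial.eval (fun q => X q.1 q.2) p

theorem zar_basis (a b : ℕ) : IsTopologicalBasis
    {U : Set (Matrix (Fin a) (Fin b) ℂ) | ∃ p : MvPolynomial (Fin a × Fin b) ℂ,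
      U = {X | MvPolynomial.eval (fun q => X q.1 q.2) p ≠ 0}} where
  exists_subset_inter := by
    rintro _ ⟨p, rfl⟩ _ ⟨q, rfl⟩ x ⟨hx, hy⟩
    refine ⟨_, ⟨p * q, rfl⟩, ?_, ?_⟩
    · simpa using ⟨hx, hy⟩
    · intro y hy
      simpa [not_or] using hy
  sUnion_eq := by
    apply Set.eq_univ_of_univ_subset
    intro x _
    exact ⟨_, ⟨1, rfl⟩, by simp⟩
  eq_generateFrom := rfl

theorem mem_closure_zar {a b : ℕ} {T : Set (Matrix (Fin a) (Fin b) ℂ)}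
    {X : Matrix (Fin a) (Fin b) ℂ} :
    X ∈ closure T ↔ ∀ p, (∀ Y ∈ T, pev Y p = 0) → pev X p = 0 := by
  rw [(zar_basis a b).mem_closure_iff]
  constructor
  · intro h p hp
    by_contra hX
    obtain ⟨Y, hY, hYT⟩ := h _ ⟨p, rfl⟩ hX
    exact hY (hp Y hYT)
  · rintro h _ ⟨p, rfl⟩ hX
    by_contra hne
    apply hX
    apply h p
    intro Y hY
    by_contra hY2
    exact hne ⟨Y, hY2, hY⟩

theorem mem_closure_sub {a b : ℕ} {S : Set (Matrix (Fin a) (Fin b) ℂ)} {T : Set S} {X : S} :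
    X ∈ closure T ↔ ∀ p, (∀ Y ∈ T, pev Y.1 p = 0) → pev X.1 p = 0 := by
  rw [closure_subtype, mem_closure_zar]
  simp

theorem isClosed_zero {a b : ℕ} (S : Set (Matrix (Fin a) (Fin b) ℂ))
    (p : MvPolynomial (Fin a × Fin b) ℂ) : IsClosed {X : S | pev X.1 p = 0} := by
  apply isClosed_of_closure_subset
  intro X hX
  exact mem_closure_sub.1 hX p (fun Y hY => hY)

/-- polynomial functions -/
def PolyFn {κ : Type} (f : (κ → ℂ) → ℂ) : Prop :=
  ∃ P : MvPolynomial κ ℂ, ∀ x, f x = MvPolynomial.eval x P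

theorem PolyFn.const {κ : Type} (c : ℂ) : PolyFn (fun _ : κ → ℂ => c) :=
  ⟨MvPolynomial.C c, by simp⟩
theorem PolyFn.var {κ : Type} (k : κ) : PolyFn (fun x : κ → ℂ => x k) :=
  ⟨MvPolynomial.X k, by simp⟩
theorem PolyFn.add {κ : Type} {f g : (κ → ℂ) → ℂ} (hf : PolyFn f) (hg : PolyFn g) :
    PolyFn (fun x => f x + g x) := by
  obtain ⟨P, hP⟩ := hf
  obtain ⟨Q, hQ⟩ := hg
  exact ⟨P + Q, by simp [hP, hQ]⟩
theorem PolyFn.sub {κ : Type} {f g : (κ → ℂ) → ℂ} (hf : PolyFn f) (hg : PolyFn g) :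
    PolyFn (fun x => f x - g x) := by
  obtain ⟨P, hP⟩ := hf
  obtain ⟨Q, hQ⟩ := hg
  exact ⟨P - Q, by simp [hP, hQ]⟩
theorem PolyFn.mul {κ : Type} {f g : (κ → ℂ) → ℂ} (hf : PolyFn f) (hg : PolyFn g) :
    PolyFn (fun x => f x * g x) := by
  obtain ⟨P, hP⟩ := hf
  obtain ⟨Q, hQ⟩ := hg
  exact ⟨P * Q, by simp [hP, hQ]⟩
theorem PolyFn.sum {κ ι : Type} (s : Finset ι) {f : ι → (κ → ℂ) → ℂ} (hf : ∀ i, PolyFn (f i)) :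
    PolyFn (fun x => ∑ i ∈ s, f i x) := by
  choose P hP using hf
  exact ⟨∑ i ∈ s, P i, by simp [hP]⟩
theorem PolyFn.comp {κ ι : Type} {f : (κ → ℂ) → ℂ} {g : (ι → ℂ) → (κ → ℂ)} (hf : PolyFn f)
    (hg : ∀ k, PolyFn (fun x => g x k)) : PolyFn (fun x => f (g x)) := by
  obtain ⟨P, hP⟩ := hf
  choose Q hQ using hg
  refine ⟨MvPolynomial.aeval Q P, fun x => ?_⟩
  change f (g x) = _
  rw [hP]
  have : g x = fun k => MvPolynomial.eval x (Q k) := by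
    funext k; exact hQ k x
  rw [this]
  rw [MvPolynomial.aeval_def, ← MvPolynomial.coe_eval₂Hom]
  change _ = ((MvPolynomial.eval x).comp _) P
  congr 1
  ext <;> simp

/-- polynomial maps -/
def IsPolyMap {κ : Type} {a b : ℕ} (φ : (κ → ℂ) → Matrix (Fin a) (Fin b) ℂ) : Prop :=
  ∀ i j, PolyFn (fun x => φ x i j)

theorem IsPolyMap.comp_pev {κ : Type} {a b : ℕ} {φ : (κ → ℂ) → Matrix (Fin a) (Fin b) ℂ}
    (h : IsPolyMap φ) (p : MvPolynomial (Fin a × Fin b) ℂ) : PolyFn (fun x => pev (φ x) p) := by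
  have h1 : PolyFn (fun y : Fin a × Fin b → ℂ => MvPolynomial.eval y p) := ⟨p, fun _ => rfl⟩
  have h2 := PolyFn.comp (g := fun x q => φ x q.1 q.2) h1 (fun q => h q.1 q.2)
  obtain ⟨P, hP⟩ := h2
  refine ⟨P, fun x => ?_⟩
  rw [← hP x]
  rfl

theorem isPoly_mul_ne {κ : Type} {f g : (κ → ℂ) → ℂ} (hf : PolyFn f) (hg : PolyFn g)
    {x y : κ → ℂ} (hx : f x ≠ 0) (hy : g y ≠ 0) : ∃ z, f z ≠ 0 ∧ g z ≠ 0 := by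
  obtain ⟨P, hP⟩ := hf
  obtain ⟨Q, hQ⟩ := hg
  by_contra! h
  have : P * Q = 0 := by
    apply MvPolynomial.funext
    intro z
    simp only [map_mul, map_zero, mul_eq_zero, ← hP, ← hQ]
    by_cases h0 : f z = 0
    · exact Or.inl h0
    · exact Or.inr (h z h0)
  rcases mul_eq_zero.1 this with h | h
  · apply hx; simp [hP, h]
  · apply hy; simp [hQ, h]

theorem irred_range {κ : Type} {a b : ℕ} {S : Set (Matrix (Fin a) (Fin b) ℂ)}
    (φ : (κ → ℂ) → S) (h : IsPolyMap (fun x => (φ x).1)) : IsIrreducible (Set.range φ) := by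
  refine ⟨Set.range_nonempty _, ?_⟩
  rintro _ _ ⟨U, hU, rfl⟩ ⟨V, hV, rfl⟩ ⟨_, ⟨x, rfl⟩, hx⟩ ⟨_, ⟨y, rfl⟩, hy⟩
  obtain ⟨_, ⟨p, rfl⟩, hxp, hpU⟩ := (zar_basis a b).exists_subset_of_mem_open hx hU
  obtain ⟨_, ⟨q, rfl⟩, hyq, hqV⟩ := (zar_basis a b).exists_subset_of_mem_open hy hV
  obtain ⟨z, hz1, hz2⟩ := isPoly_mul_ne (h.comp_pev p) (h.comp_pev q) hxp hyq
  exact ⟨φ z, ⟨z, rfl⟩, hpU hz1, hqV hz2⟩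

/-- vanishing ideal -/
def vid {a b : ℕ} {S : Set (Matrix (Fin a) (Fin b) ℂ)} (T : Set S) :
    Ideal (MvPolynomial (Fin a × Fin b) ℂ) where
  carrier := {p | ∀ X ∈ T, pev X.1 p = 0}
  add_mem' := by
    intro p q hp hq X hX
    have h1 := hp X hX
    have h2 := hq X hX
    simp only [pev] at *
    simp [h1, h2]
  zero_mem' := by intro X _; simp [pev]
  smul_mem' := by
    intro c p hp X hX
    have h1 := hp X hX
    simp only [pev] at *
    simp [h1]

theorem vid_prime {a b : ℕ} {S : Set (Matrix (Fin a) (Fin b) ℂ)} (T : Set S)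
    (hT : IsIrreducible T) : (vid T).IsPrime := by
  constructor
  · intro h
    obtain ⟨X, hX⟩ := hT.1
    have : (1 : MvPolynomial (Fin a × Fin b) ℂ) ∈ vid T := by rw [h]; trivial
    have := this X hX
    simp [pev] at this
  · intro p q hpq
    have := isPreirreducible_iff_isClosed_union_isClosed.1 hT.2 _ _ (isClosed_zero S p)
      (isClosed_zero S q) (fun X hX => by
        have := hpq X hX
        simpa [pev] using this)
    exact this

theorem ringKrullDim_le_of_inj (R : Type) [CommRing R] [IsDomain R] [Algebra ℂ R] [Algebra.FiniteType ℂ R]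
    (d : ℕ) (f : R →ₐ[ℂ] MvPolynomial (Fin d) ℂ) (hf : Function.Injective f) :
    ringKrullDim R ≤ d := by
  obtain ⟨s, g, ginj, gint⟩ := exists_integral_inj_algHom_of_fg ℂ R
  have hs : s ≤ d := by
    have h1 := lift_trdeg_le_of_injective (f.comp g) (hf.comp ginj)
    rw [MvPolynomial.trdeg_of_isDomain, MvPolynomial.trdeg_of_isDomain] at h1
    simpa using h1
  have h2 : ringKrullDim R ≤ ringKrullDim (MvPolynomial (Fin s) ℂ) := by
    let := g.toRingHom.toAlgebra
    have : Algebra.IsIntegral (MvPolynomial (Fin s) ℂ) R := ⟨gint⟩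
    refine krullDim_le_of_strictMono (PrimeSpectrum.comap (algebraMap (MvPolynomial (Fin s) ℂ) R)) ?_
    intro I J hIJ
    exact Ideal.IsIntegral.comap_lt_comap (R := MvPolynomial (Fin s) ℂ) (I := I.asIdeal) (J := J.asIdeal) hIJ
  refine h2.trans ?_
  rw [MvPolynomial.ringKrullDim_of_isNoetherianRing]
  simp [ringKrullDim_eq_zero_of_field]
  exact_mod_cast hs

/-- finite polynomial covering -/
def Covered {a b : ℕ} (S : Set (Matrix (Fin a) (Fin b) ℂ)) (d : ℕ) : Prop :=
  ∃ (J : Type) (_ : Finite J) (φ : J → (Fin d → ℂ) → Matrix (Fin a) (Fin b) ℂ),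
    (∀ j, IsPolyMap (φ j)) ∧ ∀ X ∈ S, ∃ j x, φ j x = X

theorem Covered.dim_le {a b : ℕ} {S : Set (Matrix (Fin a) (Fin b) ℂ)} {d : ℕ}
    (h : Covered S d) : topologicalKrullDim S ≤ d := by
  obtain ⟨J, hJ, φ, hφ, hS⟩ := h
  unfold topologicalKrullDim
  rw [krullDim_eq_iSup_height]
  refine iSup_le fun T => ?_
  rw [height_eq_krullDim_Iic]
  -- find the index
  have key : ∃ j, ∀ p, (∀ x, pev (φ j x) p = 0) → p ∈ vid (T : Set S) := by
    have := vid_prime _ T.isIrreducible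
    by_contra! hcon
    choose p hp hpT using hcon
    have := Fintype.ofFinite J
    have hprod : ∏ j, p j ∈ vid (T : Set S) := by
      intro X hX
      obtain ⟨j, x, hx⟩ := hS X.1 X.2
      have := hp j x
      rw [hx] at this
      simp only [pev, map_prod]
      exact Finset.prod_eq_zero (Finset.mem_univ j) this
    rw [Ideal.IsPrime.prod_mem_iff] at hprod
    obtain ⟨j, _, hj⟩ := hprod
    exact hpT j hj
  obtain ⟨j, hj⟩ := key
  choose P hP using hφ j
  let F : MvPolynomial (Fin a × Fin b) ℂ →ₐ[ℂ] MvPolynomial (Fin d) ℂ :=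
    MvPolynomial.aeval (fun q => P q.1 q.2)
  have hF : ∀ p x, MvPolynomial.eval x (F p) = pev (φ j x) p := by
    intro p x
    have : (fun q : Fin a × Fin b => φ j x q.1 q.2) = fun q => MvPolynomial.eval x (P q.1 q.2) := by
      funext q; exact hP _ _ _
    simp only [F, pev]
    rw [this]
    rw [MvPolynomial.aeval_def, ← MvPolynomial.coe_eval₂Hom]
    change ((MvPolynomial.eval x).comp _) p = _
    congr 1
    ext <;> simp
  have hker : ∀ p ∈ RingHom.ker F, p ∈ vid (T : Set S) := by
    intro p hp
    apply hj
    intro x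
    rw [← hF, (RingHom.mem_ker).1 hp, map_zero]
  have hdim : ringKrullDim (MvPolynomial (Fin a × Fin b) ℂ ⧸ RingHom.ker F) ≤ d := by
    have : (RingHom.ker F).IsPrime := RingHom.ker_isPrime _
    exact ringKrullDim_le_of_inj _ d (Ideal.kerLiftAlg F) (Ideal.kerLiftAlg_injective F)
  refine le_trans ?_ hdim
  rw [ringKrullDim_quotient, ← krullDim_orderDual (α := Set.Iic T)]
  let G : (Set.Iic T) → PrimeSpectrum.zeroLocus (R := MvPolynomial (Fin a × Fin b) ℂ) (RingHom.ker F : Set _) :=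
    fun Z => ⟨⟨vid (Z.1 : Set S), vid_prime _ Z.1.isIrreducible⟩, fun p hp X hX => hker p hp X (Z.2 hX)⟩
  refine krullDim_le_of_strictMono (fun Z => G (OrderDual.ofDual Z)) ?_
  intro Z W hZW
  have hZW' : (OrderDual.ofDual W).1 < (OrderDual.ofDual Z).1 := hZW
  change vid _ < vid _
  refine lt_of_le_not_ge (fun p hp X hX => hp X (hZW'.le hX)) fun hle => ?_
  apply hZW'.not_ge
  intro X hX
  change X ∈ ((OrderDual.ofDual W).1 : Set S)
  rw [← (OrderDual.ofDual W).1.isClosed.closure_eq]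
  apply mem_closure_sub.2
  intro p hp
  exact hle hp X hX

theorem sparse_param {n s : ℕ} (hs : s ≤ n) {u : Fin n → ℂ} (hu : Sparse s u) :
    ∃ (a : Fin s → Fin n) (y : Fin s → ℂ), ∀ i, u i = ∑ k, if a k = i then y k else 0 := by
  classical
  unfold Sparse at hu
  have h1 : (Finset.univ.filter (fun i => u i ≠ 0)).card ≤ s := by
    rw [Set.ncard_eq_toFinset_card'] at hu
    simpa using hu
  obtain ⟨I, hI, -, hc⟩ := Finset.exists_subsuperset_card_eq (Finset.subset_univ _) h1 (by simpa using hs)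
  refine ⟨I.orderEmbOfFin hc, fun k => u (I.orderEmbOfFin hc k), fun i => ?_⟩
  by_cases hi : i ∈ I
  · have : i ∈ Set.range (I.orderEmbOfFin hc) := by simpa using hi
    obtain ⟨k, rfl⟩ := this
    rw [Finset.sum_eq_single k]
    · simp
    · intro b _ hb
      simp [hb]
    · simp
  · have h0 : u i = 0 := by
      by_contra h
      exact hi (hI (by simpa using h))
    rw [h0, eq_comm]
    apply Finset.sum_eq_zero
    intro k _
    rw [if_neg]
    rintro rfl
    exact hi (I.orderEmbOfFin_mem hc k)

/-- normalised rank one matrices -/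
def N1 (n₁ n₂ t s : ℕ) : Set (Matrix (Fin n₁) (Fin n₂) ℂ) :=
  {X | ∃ (i₀ : Fin n₁) (w : Fin n₁ → ℂ) (v : Fin n₂ → ℂ), Sparse t w ∧ Sparse s v ∧
    X = Matrix.vecMulVec (Pi.single i₀ 1 + w) v}

theorem N1_covered {n₁ n₂ t s : ℕ} (ht : t ≤ n₁) (hs : s ≤ n₂) :
    Covered (N1 n₁ n₂ t s) (t + s) := by
  classical
  refine ⟨Fin n₁ × (Fin t → Fin n₁) × (Fin s → Fin n₂), inferInstance, fun J x =>
    Matrix.of fun i j => ((Pi.single J.1 1 : Fin n₁ → ℂ) i +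
      ∑ k, if J.2.1 k = i then x (Fin.castAdd s k) else 0) *
      ∑ k, if J.2.2 k = j then x (Fin.natAdd t k) else 0, ?_, ?_⟩
  · rintro ⟨i₀, a, b⟩ i j
    simp only [Matrix.of_apply]
    refine ((PolyFn.const _).add (PolyFn.sum _ fun k => ?_)).mul (PolyFn.sum _ fun k => ?_)
    · split_ifs
      · exact PolyFn.var _
      · exact PolyFn.const _
    · split_ifs
      · exact PolyFn.var _
      · exact PolyFn.const _
  · rintro X ⟨i₀, w, v, hw, hv, rfl⟩
    obtain ⟨a, y, hy⟩ := sparse_param ht hw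
    obtain ⟨b, z, hz⟩ := sparse_param hs hv
    refine ⟨(i₀, a, b), Fin.append y z, ?_⟩
    ext i j
    simp [Matrix.vecMulVec_apply, hy i, hz j]

theorem Covered.diff {a b : ℕ} {S : Set (Matrix (Fin a) (Fin b) ℂ)} {d : ℕ}
    (h : Covered S d) : Covered (diffSet S) (d + d) := by
  obtain ⟨J, hJ, φ, hφ, hS⟩ := h
  refine ⟨J × J, inferInstance, fun j x => φ j.1 (fun k => x (Fin.castAdd d k)) -
    φ j.2 (fun k => x (Fin.natAdd d k)), ?_, ?_⟩
  · rintro ⟨j, j'⟩ i l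
    simp only [Matrix.sub_apply]
    exact ((hφ j i l).comp (g := fun x k => x (Fin.castAdd d k)) fun k => PolyFn.var _).sub
      ((hφ j' i l).comp (g := fun x k => x (Fin.natAdd d k)) fun k => PolyFn.var _)
  · rintro Z ⟨X, hX, Y, hY, rfl⟩
    obtain ⟨j, x, rfl⟩ := hS X hX
    obtain ⟨j', y, rfl⟩ := hS Y hY
    exact ⟨(j, j'), Fin.append x y, by simp only [Fin.append_left, Fin.append_right]⟩

theorem Covered.mono {a b : ℕ} {S T : Set (Matrix (Fin a) (Fin b) ℂ)} {d : ℕ}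
    (h : Covered S d) (hT : T ⊆ S) : Covered T d := by
  obtain ⟨J, hJ, φ, hφ, hS⟩ := h
  exact ⟨J, hJ, φ, hφ, fun X hX => hS X (hT hX)⟩

theorem sparse_of_subset {n s : ℕ} {u : Fin n → ℂ} (I : Finset (Fin n)) (hI : I.card ≤ s)
    (h : ∀ i, i ∉ I → u i = 0) : Sparse s u := by
  unfold Sparse
  refine le_trans ?_ hI
  rw [← Set.ncard_coe_finset]
  apply Set.ncard_le_ncard _ (Finset.finite_toSet I)
  intro i hi
  by_contra hc
  exact hi (h i hc)

theorem M1_sub {n₁ n₂ s₁ s₂ : ℕ} (hn : 1 ≤ n₁) (hs₁ : 1 ≤ s₁) :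
    M1 n₁ n₂ s₁ s₂ ⊆ N1 n₁ n₂ (s₁ - 1) s₂ := by
  classical
  rintro X ⟨u, v, hu, hv, rfl⟩
  by_cases h : ∃ i, u i ≠ 0
  · obtain ⟨i₀, hi⟩ := h
    refine ⟨i₀, fun i => if i = i₀ then 0 else u i / u i₀, u i₀ • v, ?_, ?_, ?_⟩
    · unfold Sparse at hu
      apply sparse_of_subset ((Finset.univ.filter (fun i => u i ≠ 0)).erase i₀)
      · rw [Finset.card_erase_of_mem (by simpa using hi)]
        rw [Set.ncard_eq_toFinset_card'] at hu
        have : (Finset.univ.filter (fun i => u i ≠ 0)).card ≤ s₁ := by simpa using hu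
        omega
      · intro i h1
        by_cases h2 : i = i₀
        · simp [h2]
        · have : u i = 0 := by simpa [h2] using h1
          simp [this]
    · unfold Sparse at *
      refine le_trans (Set.ncard_le_ncard ?_ (Set.toFinite _)) hv
      intro i h1 h2
      apply h1
      simp [h2]
    · ext i j
      simp only [Matrix.vecMulVec_apply, Pi.add_apply, Pi.smul_apply, smul_eq_mul, Pi.single_apply]
      split_ifs with h2
      · subst h2; ring
      · field_simp; ring
  · push Not at h
    refine ⟨⟨0, hn⟩, 0, 0, ?_, ?_, ?_⟩
    · simp [Sparse]
    · simp [Sparse]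
    · ext i j
      simp [Matrix.vecMulVec_apply, h]

theorem sparse_full {n : ℕ} (u : Fin n → ℂ) : Sparse n u :=
  sparse_of_subset Finset.univ (by simp) (by simp)

theorem rank2_sub {n₁ n₂ : ℕ} (hn : 2 ≤ n₁) :
    diffSet (M1 n₁ n₂ n₁ n₂) ⊆ diffSet (N1 n₁ n₂ (n₁ - 2) n₂) := by
  classical
  rintro Z ⟨_, ⟨u, v, -, -, rfl⟩, _, ⟨u', v', -, -, rfl⟩, rfl⟩
  have key : ∃ (a b : Fin n₁) (c d : Fin n₁ → ℂ), a ≠ b ∧ c a = 1 ∧ c b = 0 ∧ d a = 0 ∧ d b = 1 ∧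
      ∀ i, u i = c i * u a + d i * u b ∧ u' i = c i * u' a + d i * u' b := by
    by_cases h : ∃ a b, u a * u' b - u b * u' a ≠ 0
    · obtain ⟨a, b, h⟩ := h
      refine ⟨a, b, fun i => (u i * u' b - u b * u' i) / (u a * u' b - u b * u' a),
        fun i => (u a * u' i - u i * u' a) / (u a * u' b - u b * u' a), ?_, ?_, ?_, ?_, ?_, ?_⟩
      · rintro rfl
        exact h (by ring)
      · simp [div_self h]
      · simp only [div_eq_zero_iff]; left; ring
      · simp only [div_eq_zero_iff]; left; ring
      · simp [div_self h]
      · intro i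
        constructor
        · rw [div_mul_eq_mul_div, div_mul_eq_mul_div, ← add_div, eq_div_iff h]; ring
        · rw [div_mul_eq_mul_div, div_mul_eq_mul_div, ← add_div, eq_div_iff h]; ring
    · push Not at h
      by_cases h0 : ∃ a, u a ≠ 0 ∨ u' a ≠ 0
      · obtain ⟨a, ha⟩ := h0
        have : Nontrivial (Fin n₁) := Fin.nontrivial_iff_two_le.2 hn
        obtain ⟨b, hb⟩ := exists_ne a
        have hc : ∃ c : Fin n₁ → ℂ, ∀ i, u i = c i * u a ∧ u' i = c i * u' a := by
          rcases ha with ha | ha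
          · refine ⟨fun i => u i / u a, fun i => ⟨by field_simp, ?_⟩⟩
            have := h a i
            field_simp
            linear_combination this
          · refine ⟨fun i => u' i / u' a, fun i => ⟨?_, by field_simp⟩⟩
            have := h a i
            field_simp
            linear_combination -this
        obtain ⟨c, hc⟩ := hc
        refine ⟨a, b, fun i => if i = b then 0 else if i = a then 1 else c i,
          fun i => if i = b then 1 else 0, hb.symm, by simp [hb.symm], by simp, by simp [hb.symm],
          by simp, fun i => ?_⟩
        by_cases hib : i = b
        · simp [hib]
        · by_cases hia : i = a
          · simp [hia, hb.symm]
          · simpa [hia, hib] using hc i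
      · push Not at h0
        have h01 : (⟨0, by omega⟩ : Fin n₁) ≠ ⟨1, by omega⟩ := by simp
        refine ⟨⟨0, by omega⟩, ⟨1, by omega⟩, Pi.single ⟨0, by omega⟩ 1, Pi.single ⟨1, by omega⟩ 1,
          h01, Pi.single_eq_same _ _, Pi.single_eq_of_ne h01.symm _, Pi.single_eq_of_ne h01 _,
          Pi.single_eq_same _ _, fun i => ?_⟩
        simp [h0]
  obtain ⟨a, b, c, d, hab, hca, hcb, hda, hdb, hi⟩ := key
  have hcard : ((Finset.univ.erase a).erase b).card ≤ n₁ - 2 := by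
    rw [Finset.card_erase_of_mem (by simp [hab.symm]), Finset.card_erase_of_mem (by simp)]
    simp; omega
  refine ⟨_, ⟨a, c - Pi.single a 1, fun j => u a * v j - u' a * v' j, ?_, sparse_full _, rfl⟩,
    _, ⟨b, d - Pi.single b 1, fun j => - (u b * v j - u' b * v' j), ?_, sparse_full _, rfl⟩, ?_⟩
  · refine sparse_of_subset _ hcard fun i h => ?_
    by_cases hib : i = b
    · subst hib; simp [hcb, hab.symm]
    · have : i = a := by simpa [hib] using h
      subst this; simp [hca]
  · refine sparse_of_subset _ hcard fun i h => ?_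
    by_cases hib : i = b
    · subst hib; simp [hdb]
    · have : i = a := by simpa [hib] using h
      subst this; simp [hda, hab]
  · ext i j
    simp only [Matrix.sub_apply, Matrix.vecMulVec_apply, add_sub_cancel]
    rw [(hi i).1, (hi i).2]
    ring

/-- restrict a parameter to a finset -/
def mask {κ : Type} [DecidableEq κ] (F : Finset κ) (x : κ → ℂ) : κ → ℂ :=
  fun k => if k ∈ F then x k else 0

/-- certificate for a lower bound of the dimension -/
def Cert {a b : ℕ} (S : Set (Matrix (Fin a) (Fin b) ℂ)) (d : ℕ) : Prop :=
  ∃ (κ : Type) (_ : DecidableEq κ) (φ : (κ → ℂ) → Matrix (Fin a) (Fin b) ℂ) (A B : Finset κ)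
    (e : κ → Fin a) (f : κ → Fin b) (c : κ → ℂ), IsPolyMap φ ∧ Disjoint A B ∧
    d ≤ A.card + B.card ∧
    (∀ k ∈ A, ∀ x, (∀ l, l ∉ A → x l = 0) → φ x (e k) (f k) = c k + x k) ∧
    (∀ k ∈ B, ∀ x, (∀ l, l ∉ A ∪ B → x l = 0) → φ x (e k) (f k) = c k + x k) ∧
    (∀ x, (∀ l, l ∉ A ∪ B → x l = 0) → φ x ∈ S)

theorem Cert.le_dim {a b : ℕ} {S : Set (Matrix (Fin a) (Fin b) ℂ)} {d : ℕ}
    (h : Cert S d) : (d : WithBot ℕ∞) ≤ topologicalKrullDim S := by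
  obtain ⟨κ, _, φ, A, B, e, f, c, hφ, hAB, hd, hA, hB, hS⟩ := h
  have hmS : ∀ F ⊆ A ∪ B, ∀ x, φ (mask F x) ∈ S := fun F hF x => hS _ fun l hl => by
    simp only [mask]
    rw [if_neg (fun h => hl (hF h))]
  let g : (F : Finset κ) → F ⊆ A ∪ B → (κ → ℂ) → S := fun F hF x => ⟨φ (mask F x), hmS F hF x⟩
  have hg : ∀ F hF, IsIrreducible (Set.range (g F hF)) := by
    intro F hF
    apply irred_range
    intro i j
    refine (hφ i j).comp (g := fun x => mask F x) fun k => ?_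
    by_cases hk : k ∈ F
    · simp only [mask, hk, if_true]; exact PolyFn.var k
    · simp only [mask, hk, if_false]; exact PolyFn.const 0
  let T : (F : Finset κ) → F ⊆ A ∪ B → IrreducibleCloseds S := fun F hF =>
    ⟨closure (Set.range (g F hF)), (hg F hF).closure, isClosed_closure⟩
  have hlt : ∀ F k (hk : k ∉ F) (hF : insert k F ⊆ A ∪ B),
      (∀ x, (∀ l, l ∉ insert k F → x l = 0) → φ x (e k) (f k) = c k + x k) →
      T F ((Finset.subset_insert k F).trans hF) < T (insert k F) hF := by
    intro F k hk hF hx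
    refine lt_of_le_not_ge ?_ ?_
    · change closure _ ⊆ closure _
      apply closure_mono
      rintro _ ⟨x, rfl⟩
      refine ⟨mask F x, Subtype.ext ?_⟩
      change φ (mask (insert k F) (mask F x)) = φ (mask F x)
      congr 1
      funext l
      by_cases hl : l ∈ F <;> simp [mask, hl]
    · intro hle
      have hmem : g (insert k F) hF (fun _ => 1) ∈ closure (Set.range (g F ((Finset.subset_insert k F).trans hF))) :=
        hle (subset_closure ⟨_, rfl⟩)
      have := mem_closure_sub.1 hmem (MvPolynomial.X (e k, f k) - MvPolynomial.C (c k)) (by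
        rintro _ ⟨x, rfl⟩
        change MvPolynomial.eval _ _ = 0
        simp only [map_sub, MvPolynomial.eval_X, MvPolynomial.eval_C]
        change φ (mask F x) (e k) (f k) - c k = 0
        rw [hx]
        · simp [mask, hk]
        · intro l hl
          have : l ∉ F := fun h => hl (Finset.mem_insert_of_mem h)
          simp [mask, this])
      change MvPolynomial.eval _ _ = 0 at this
      simp only [map_sub, MvPolynomial.eval_X, MvPolynomial.eval_C] at this
      change φ (mask (insert k F) (fun _ => 1)) (e k) (f k) - c k = 0 at this
      rw [hx] at this
      · simp [mask] at this
      · intro l hl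
        simp only [mask]
        rw [if_neg hl]
  have h1 : ∀ F : Finset κ, (hF : F ⊆ A) → (F.card : ℕ∞) ≤ height (T F (hF.trans Finset.subset_union_left)) := by
    intro F
    induction F using Finset.induction_on with
    | empty => intro hF; simp
    | insert k F hk ih =>
      intro hF
      rw [Finset.card_insert_of_notMem hk]
      have hF' := (Finset.subset_insert k F).trans hF
      have := height_add_one_le (hlt F k hk (hF.trans Finset.subset_union_left) (fun x hx => hA k (hF (Finset.mem_insert_self k F)) x
        (fun l hl => hx l (fun h => hl (hF h)))))
      refine le_trans ?_ this
      push_cast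
      gcongr
      exact ih hF'
  have h2 : ∀ G : Finset κ, (hG : G ⊆ B) → ((A.card + G.card : ℕ) : ℕ∞) ≤
      height (T (G ∪ A) (Finset.union_subset (hG.trans Finset.subset_union_right) Finset.subset_union_left)) := by
    intro G
    induction G using Finset.induction_on with
    | empty => intro hG; simpa using h1 A subset_rfl
    | insert k F hk ih =>
      intro hF
      rw [Finset.card_insert_of_notMem hk]
      have hF' := (Finset.subset_insert k F).trans hF
      have hkB := hF (Finset.mem_insert_self k F)
      have hkA : k ∉ F ∪ A := by
        rw [Finset.mem_union, not_or]
        exact ⟨hk, fun h => (Finset.disjoint_left.1 hAB h) hkB⟩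
      have hsub : insert k (F ∪ A) ⊆ A ∪ B := by
        rw [← Finset.insert_union]
        exact Finset.union_subset (hF.trans Finset.subset_union_right) Finset.subset_union_left
      have := height_add_one_le (hlt (F ∪ A) k hkA hsub (fun x hx => hB k hkB x
        (fun l hl => hx l (fun h => hl (hsub h)))))
      simp only [Finset.insert_union]
      refine le_trans ?_ this
      rw [← add_assoc]
      push_cast
      gcongr
      exact_mod_cast ih hF'
  have h3 := h2 B subset_rfl
  refine le_trans ?_ (height_le_krullDim (T (B ∪ A) (Finset.union_subset Finset.subset_union_right Finset.subset_union_left)))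
  have h4 : (d : ℕ∞) ≤ ((A.card + B.card : ℕ) : ℕ∞) := by exact_mod_cast hd
  exact_mod_cast h4.trans h3

theorem Cert.transpose {n₁ n₂ s₁ s₂ d : ℕ} (h : Cert (diffSet (M1 n₁ n₂ s₁ s₂)) d) :
    Cert (diffSet (M1 n₂ n₁ s₂ s₁)) d := by
  obtain ⟨κ, i, φ, A, B, e, f, c, hφ, hAB, hd, hA, hB, hS⟩ := h
  refine ⟨κ, i, fun x => (φ x).transpose, A, B, f, e, c, fun i j => hφ j i, hAB, hd, hA, hB, ?_⟩
  intro x hx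
  obtain ⟨_, ⟨u, v, hu, hv, rfl⟩, _, ⟨u', v', hu', hv', rfl⟩, h⟩ := hS x hx
  refine ⟨_, ⟨v, u, hv, hu, rfl⟩, _, ⟨v', u', hv', hu', rfl⟩, ?_⟩
  change (φ x).transpose = _
  rw [h]
  ext i j
  simp [Matrix.vecMulVec_apply, mul_comm]

theorem main_cert {n₁ n₂ s₁ s₂ : ℕ} (z₀ z₁ : Fin n₁) (hz : z₀ ≠ z₁) (w₀ w₁ : Fin n₂) (hw : w₀ ≠ w₁)
    (I I' : Finset (Fin n₁)) (K K' : Finset (Fin n₂))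
    (h1 : w₀ ∉ K) (h2 : w₁ ∉ K) (h3 : w₀ ∉ K') (h4 : w₁ ∉ K')
    (hI : (insert z₀ I).card ≤ s₁) (hI' : (insert z₁ I').card ≤ s₁)
    (hK : (insert w₀ K).card ≤ s₂) (hK' : (insert w₁ K').card ≤ s₂) :
    Cert (diffSet (M1 n₁ n₂ s₁ s₂)) ((K.card + K'.card) + (I.card + I'.card)) := by
  classical
  let U : (((Fin n₁ ⊕ Fin n₁) ⊕ (Fin n₂ ⊕ Fin n₂)) → ℂ) → Fin n₁ → ℂ := fun x i => (Pi.single z₀ 1 : Fin n₁ → ℂ) i + x (.inl (.inl i))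
  let U' : (((Fin n₁ ⊕ Fin n₁) ⊕ (Fin n₂ ⊕ Fin n₂)) → ℂ) → Fin n₁ → ℂ := fun x i => (Pi.single z₁ 1 : Fin n₁ → ℂ) i + x (.inl (.inr i))
  let V : (((Fin n₁ ⊕ Fin n₁) ⊕ (Fin n₂ ⊕ Fin n₂)) → ℂ) → Fin n₂ → ℂ := fun x i => (Pi.single w₀ 1 : Fin n₂ → ℂ) i + x (.inr (.inl i))
  let V' : (((Fin n₁ ⊕ Fin n₁) ⊕ (Fin n₂ ⊕ Fin n₂)) → ℂ) → Fin n₂ → ℂ := fun x i => (Pi.single w₁ 1 : Fin n₂ → ℂ) i + x (.inr (.inr i))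
  refine ⟨((Fin n₁ ⊕ Fin n₁) ⊕ (Fin n₂ ⊕ Fin n₂)), inferInstance, fun x => Matrix.of fun i j => U x i * V x j + U' x i * V' x j,
    Finset.disjSum ∅ (K.disjSum K'), Finset.disjSum (I.disjSum I') ∅,
    Sum.elim (Sum.elim id id) (Sum.elim (fun _ => z₀) (fun _ => z₁)),
    Sum.elim (Sum.elim (fun _ => w₀) (fun _ => w₁)) (Sum.elim id id),
    Sum.elim (Sum.elim (Pi.single z₀ 1) (Pi.single z₁ 1)) (Sum.elim (Pi.single w₀ 1) (Pi.single w₁ 1)),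
    ?_, ?_, ?_, ?_, ?_, ?_⟩
  · intro i j
    simp only [Matrix.of_apply]
    exact (((PolyFn.const _).add (PolyFn.var _)).mul ((PolyFn.const _).add (PolyFn.var _))).add
      (((PolyFn.const _).add (PolyFn.var _)).mul ((PolyFn.const _).add (PolyFn.var _)))
  · rw [Finset.disjoint_left]
    rintro (k | k) hk hk'
    · simp at hk
    · simp at hk'
  · simp [Finset.card_disjSum]
  · intro k hk x hx
    have hl : ∀ i, x (.inl i) = 0 := fun i => hx _ (by simp)
    rcases k with k | k
    · simp at hk
    rcases k with k | k
    · simp [U, U', V, V', hl, hz]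
    · simp [U, U', V, V', hl, hz.symm]
  · intro k hk x hx
    have e1 : x (.inr (.inl w₀)) = 0 := hx _ (by simp [h1])
    have e2 : x (.inr (.inl w₁)) = 0 := hx _ (by simp [h2])
    have e3 : x (.inr (.inr w₀)) = 0 := hx _ (by simp [h3])
    have e4 : x (.inr (.inr w₁)) = 0 := hx _ (by simp [h4])
    rcases k with k | k
    swap
    · simp at hk
    rcases k with k | k
    · simp [U, U', V, V', e1, e3, hw]
    · simp [U, U', V, V', e2, e4, hw.symm]
  · intro x hx
    refine ⟨_, ⟨U x, V x, sparse_of_subset _ hI ?_, sparse_of_subset _ hK ?_, rfl⟩,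
      _, ⟨U' x, - V' x, sparse_of_subset _ hI' ?_, sparse_of_subset _ hK' ?_, rfl⟩, ?_⟩
    · intro i hi
      simp only [Finset.mem_insert, not_or] at hi
      simp only [U, Pi.single_eq_of_ne hi.1, zero_add]
      exact hx _ (by simp [hi.2])
    · intro i hi
      simp only [Finset.mem_insert, not_or] at hi
      simp only [V, Pi.single_eq_of_ne hi.1, zero_add]
      exact hx _ (by simp [hi.2])
    · intro i hi
      simp only [Finset.mem_insert, not_or] at hi
      simp only [U', Pi.single_eq_of_ne hi.1, zero_add]
      exact hx _ (by simp [hi.2])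
    · intro i hi
      simp only [Finset.mem_insert, not_or] at hi
      simp only [V', Pi.neg_apply, Pi.single_eq_of_ne hi.1, zero_add, neg_eq_zero]
      exact hx _ (by simp [hi.2])
    · ext i j
      simp [Matrix.vecMulVec_apply]

theorem cert_full {n₁ n₂ : ℕ} (hn₁ : 2 ≤ n₁) (hn₂ : 2 ≤ n₂) :
    Cert (diffSet (M1 n₁ n₂ n₁ n₂)) (2 * (n₁ + n₂ - 2)) := by
  classical
  have hw : (⟨0, by omega⟩ : Fin n₂) ≠ ⟨1, by omega⟩ := by simp
  have hz : (⟨0, by omega⟩ : Fin n₁) ≠ ⟨1, by omega⟩ := by simp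
  generalize (⟨0, by omega⟩ : Fin n₂) = w₀ at hw
  generalize (⟨1, by omega⟩ : Fin n₂) = w₁ at hw
  generalize (⟨0, by omega⟩ : Fin n₁) = z₀ at hz
  generalize (⟨1, by omega⟩ : Fin n₁) = z₁ at hz
  have hc : ((Finset.univ.erase w₀).erase w₁).card = n₂ - 2 := by
    rw [Finset.card_erase_of_mem (by simp [hw.symm]), Finset.card_erase_of_mem (by simp)]
    simp; omega
  have := main_cert (s₁ := n₁) (s₂ := n₂) z₀ z₁ hz w₀ w₁ hw Finset.univ Finset.univ
    ((Finset.univ.erase w₀).erase w₁) ((Finset.univ.erase w₀).erase w₁)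
    (by simp) (by simp) (by simp) (by simp) (card_finset_fin_le _) (card_finset_fin_le _)
    (card_finset_fin_le _) (card_finset_fin_le _)
  rw [hc] at this
  convert this using 1
  simp
  omega

theorem cert_lt {n₁ n₂ s₁ s₂ : ℕ} (hn₁ : 2 ≤ n₁) (hn₂ : 2 ≤ n₂) (hs₁ : 1 ≤ s₁) (hs₁n : s₁ ≤ n₁)
    (hs₂ : 1 ≤ s₂) (hs₂n : s₂ < n₂) :
    Cert (diffSet (M1 n₁ n₂ s₁ s₂)) (2 * (s₁ + s₂ - 1)) := by
  classical
  have hw : (⟨0, by omega⟩ : Fin n₂) ≠ ⟨1, by omega⟩ := by simp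
  have hz : (⟨0, by omega⟩ : Fin n₁) ≠ ⟨1, by omega⟩ := by simp
  generalize (⟨0, by omega⟩ : Fin n₂) = w₀ at hw
  generalize (⟨1, by omega⟩ : Fin n₂) = w₁ at hw
  generalize (⟨0, by omega⟩ : Fin n₁) = z₀ at hz
  generalize (⟨1, by omega⟩ : Fin n₁) = z₁ at hz
  have hc : ((Finset.univ.erase w₀).erase w₁).card = n₂ - 2 := by
    rw [Finset.card_erase_of_mem (by simp [hw.symm]), Finset.card_erase_of_mem (by simp)]
    simp; omega
  obtain ⟨K, hKs, hKc⟩ := Finset.exists_subset_card_eq (s := (Finset.univ.erase w₀).erase w₁)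
    (n := s₂ - 1) (by omega)
  have h0 : w₀ ∉ K := fun h => by simpa using hKs h
  have h1 : w₁ ∉ K := fun h => by simpa using hKs h
  obtain ⟨I, hI, -, hIc⟩ := Finset.exists_subsuperset_card_eq (n := s₁) (Finset.subset_univ {z₀})
    (by simpa using hs₁) (by simpa using hs₁n)
  obtain ⟨I', hI', -, hIc'⟩ := Finset.exists_subsuperset_card_eq (n := s₁) (Finset.subset_univ {z₁})
    (by simpa using hs₁) (by simpa using hs₁n)
  have := main_cert (s₁ := s₁) (s₂ := s₂) z₀ z₁ hz w₀ w₁ hw I I' K K h0 h1 h0 h1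
    (by rw [Finset.insert_eq_of_mem (by simpa using hI), hIc])
    (by rw [Finset.insert_eq_of_mem (by simpa using hI'), hIc'])
    (by rw [Finset.card_insert_of_notMem h0, hKc]; omega)
    (by rw [Finset.card_insert_of_notMem h1, hKc]; omega)
  rw [hKc, hIc, hIc'] at this
  convert this using 1
  omega

theorem stmt5 (n₁ n₂ s₁ s₂ : ℕ) (hn₁ : 2 ≤ n₁) (hn₂ : 2 ≤ n₂)
    (hs₁ : 1 ≤ s₁) (hs₁n : s₁ ≤ n₁) (hs₂ : 1 ≤ s₂) (hs₂n : s₂ ≤ n₂) :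
    letI : TopologicalSpace (Matrix (Fin n₁) (Fin n₂) ℂ) := zarMat n₁ n₂
    topologicalKrullDim (diffSet (M1 n₁ n₂ s₁ s₂)) =
      if s₁ = n₁ ∧ s₂ = n₂ then ((2 * (n₁ + n₂ - 2) : ℕ) : WithBot ℕ∞)
      else ((2 * (s₁ + s₂ - 1) : ℕ) : WithBot ℕ∞) := by
  refine le_antisymm ?_ ?_
  · split_ifs with h
    · obtain ⟨rfl, rfl⟩ := h
      have := ((N1_covered (n₁ := s₁) (n₂ := s₂) (t := s₁ - 2) (s := s₂) (by omega) le_rfl).diff.mono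
        (rank2_sub hn₁)).dim_le
      rwa [show s₁ - 2 + s₂ + (s₁ - 2 + s₂) = 2 * (s₁ + s₂ - 2) by omega] at this
    · have hsub : diffSet (M1 n₁ n₂ s₁ s₂) ⊆ diffSet (N1 n₁ n₂ (s₁ - 1) s₂) := by
        rintro _ ⟨X, hX, Y, hY, rfl⟩
        exact ⟨X, M1_sub (by omega) hs₁ hX, Y, M1_sub (by omega) hs₁ hY, rfl⟩
      have := ((N1_covered (n₁ := n₁) (n₂ := n₂) (t := s₁ - 1) (s := s₂) (by omega) hs₂n).diff.mono
        hsub).dim_le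
      rwa [show s₁ - 1 + s₂ + (s₁ - 1 + s₂) = 2 * (s₁ + s₂ - 1) by omega] at this
  · split_ifs with h
    · obtain ⟨rfl, rfl⟩ := h
      exact (cert_full hn₁ hn₂).le_dim
    · by_cases h2 : s₂ < n₂
      · exact (cert_lt hn₁ hn₂ hs₁ hs₁n hs₂ h2).le_dim
      · have h1 : s₁ < n₁ := by omega
        have := (cert_lt hn₂ hn₁ hs₂ hs₂n hs₁ h1).transpose.le_dim
        rwa [add_comm s₂ s₁] at this
end
end

section
/- Let s₁,s₂ ≥ 1 with s₁+s₂ ≤ m, let k,l ∈ ℕ satisfy s₁ ≤ k ≤ m and s₂ ≤ l ≤ m, and fix nonzero coefficient vectors a ∈ ℂ^k with at most s₁ nonzero entries and b ∈ ℂ^l with at most s₂ nonzero entries. Then for Lebesgue-almost every pair (E,D) ∈ M(m,k) × M(m,l), the vectors Ea and Db are nonzero and the restriction of the circular convolution map C to (ran(E)_{s₁} ∖ {0}) × (ran(D)_{s₂} ∖ {0}) is weakly identifiable modulo scaling at (Ea, Db): whenever v ∈ ran(E)_{s₁} and w ∈ ran(D)_{s₂} are nonzero and v ⊛ w = (Ea)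 ⊛ (Db), there exists λ ∈ ℂ∖{0} with v = λ·Ea and w = (1/λ)·Db. -/
noncomputable section

open MeasureTheory Matrix

/-- The circular convolution: `(v ⊛ w)ᵢ = Σⱼ vⱼ w_{((i−j−1) mod m)+1}` (1-based indexing),
written here with 0-based indices, the entry index `(i−j−1) mod m` being computed in `ℕ`
as `(m + i - j - 1) % m`. -/
def circConv (m : ℕ) (v w : Fin m → ℂ) : Fin m → ℂ :=
  fun i => ∑ j : Fin m, v j * w ⟨(m + i.val - j.val - 1) % m, Nat.mod_lt _ i.pos⟩

/-- A subset `V ⊆ (ℂ^{n₁}∖{0}) × (ℂ^{n₂}∖{0})` is strongly identifiable modulo scaling with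
respect to a (bilinear) map `B` if `B(u,v) = B(u′,v′)` for `(u,v),(u′,v′) ∈ V` implies that
there is `λ ≠ 0` with `u = λu′` and `v = (1/λ)v′`. -/
def StrongIdent {n₁ n₂ m : ℕ} (V : Set ((Fin n₁ → ℂ) × (Fin n₂ → ℂ)))
    (B : (Fin n₁ → ℂ) → (Fin n₂ → ℂ) → (Fin m → ℂ)) : Prop :=
  ∀ p ∈ V, ∀ q ∈ V, B p.1 p.2 = B q.1 q.2 →
    ∃ l : ℂ, l ≠ 0 ∧ p.1 = l • q.1 ∧ p.2 = l⁻¹ • q.2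

/-- The restriction of a (bilinear) map `B` to `V` is weakly identifiable modulo scaling at
`p₀ ∈ V` if `B(u,v) = B(u₀,v₀)` for `(u,v) ∈ V` implies that there is `λ ≠ 0` with
`u = λu₀` and `v = (1/λ)v₀`. -/
def WeakIdentAt {n₁ n₂ m : ℕ} (V : Set ((Fin n₁ → ℂ) × (Fin n₂ → ℂ)))
    (B : (Fin n₁ → ℂ) → (Fin n₂ → ℂ) → (Fin m → ℂ))
    (p₀ : (Fin n₁ → ℂ) × (Fin n₂ → ℂ)) : Prop :=
  ∀ q ∈ V, B q.1 q.2 = B p₀.1 p₀.2 →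
    ∃ l : ℂ, l ≠ 0 ∧ q.1 = l • p₀.1 ∧ q.2 = l⁻¹ • p₀.2

instance instHaarC1 (k : ℕ) : Measure.IsAddHaarMeasure (volume : Measure (Fin k → ℂ)) :=
  Measure.pi.isAddHaarMeasure (fun _ : Fin k => (volume : Measure ℂ))

instance instHaarC2 (m k : ℕ) : Measure.IsAddHaarMeasure (volume : Measure (Fin m → Fin k → ℂ)) :=
  Measure.pi.isAddHaarMeasure (fun _ : Fin m => (volume : Measure (Fin k → ℂ)))

instance instHaarED (m k l : ℕ) : Measure.IsAddHaarMeasure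
    (volume : Measure ((Fin m → Fin k → ℂ) × (Fin m → Fin l → ℂ))) :=
  Measure.prod.instIsAddHaarMeasure
    (volume : Measure (Fin m → Fin k → ℂ)) (volume : Measure (Fin m → Fin l → ℂ))

lemma aux_encode {m k l s₁ s₂ : ℕ} (hm : s₁ + s₂ ≤ m) (a : Fin k → ℂ) (b : Fin l → ℂ)
    (ha : Sparse s₁ a) (hb : Sparse s₂ b) (q : Fin k) (hq : a q = 1) :
    ∃ (g : Fin k → Option (Fin m)) (h : Fin l → Option (Fin m)) (j : Fin m) (x : Fin m → ℂ),
      x j = 1 ∧ a = (fun q => (g q).elim 0 x) ∧ b = (fun q => (h q).elim 0 x) := by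
  classical
  have hcard : Fintype.card ({q // a q ≠ 0} ⊕ {q // b q ≠ 0}) ≤ Fintype.card (Fin m) := by
    rw [Fintype.card_sum, Fintype.card_fin]
    unfold Sparse at ha hb
    have h1 : Fintype.card {q // a q ≠ 0} = {i | a i ≠ 0}.ncard := by
      rw [Set.ncard_eq_toFinset_card', Set.toFinset_card]; rfl
    have h2 : Fintype.card {q // b q ≠ 0} = {i | b i ≠ 0}.ncard := by
      rw [Set.ncard_eq_toFinset_card', Set.toFinset_card]; rfl
    omega
  obtain ⟨e⟩ := Function.Embedding.nonempty_of_card_le hcard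
  set x : Fin m → ℂ := Function.extend e (Sum.elim (fun q => a q.1) (fun q => b q.1)) 0 with hx
  have hxe : ∀ s, x (e s) = Sum.elim (fun q => a q.1) (fun q => b q.1) s := fun s =>
    e.injective.extend_apply _ _ _
  have hq' : a q ≠ 0 := by rw [hq]; exact one_ne_zero
  refine ⟨fun q => if h : a q ≠ 0 then some (e (Sum.inl ⟨q, h⟩)) else none,
    fun q => if h : b q ≠ 0 then some (e (Sum.inr ⟨q, h⟩)) else none,
    e (Sum.inl ⟨q, hq'⟩), x, by rw [hxe]; exact hq, ?_, ?_⟩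
  · funext r
    by_cases h : a r = 0
    · simp [h]
    · simp [h, hxe]
  · funext r
    by_cases h : b r = 0
    · simp [h]
    · simp [h, hxe]

def cc {m k l : ℕ} (a : Fin k → ℂ) (b : Fin l → ℂ) (A : (Fin m → ℂ) → Fin k → ℂ)
    (B : (Fin m → ℂ) → Fin l → ℂ) (x : Fin m → ℂ) (d : Fin l → ℂ) (q : Fin k) : ℂ :=
  a q * (∑ r, d r * b r) - A x q * (∑ r, d r * B x r)

lemma aux_null {m k l : ℕ} (i : Fin m) (q : Fin k) (z : ℂ) :
    (volume : Measure ((Fin m → Fin k → ℂ) × (Fin m → Fin l → ℂ))) {ED | ED.1 i q = z} = 0 := by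
  have h := Measure.addHaar_affineSubspace
    (volume : Measure ((Fin m → Fin k → ℂ) × (Fin m → Fin l → ℂ)))
    ((AffineSubspace.mk' z (⊥ : Submodule ℝ ℂ)).comap
      (((LinearMap.proj q : (Fin k → ℂ) →ₗ[ℝ] ℂ) ∘ₗ
        (LinearMap.proj i : (Fin m → Fin k → ℂ) →ₗ[ℝ] (Fin k → ℂ)) ∘ₗ
        LinearMap.fst ℝ (Fin m → Fin k → ℂ) (Fin m → Fin l → ℂ)).toAffineMap)) (by
      intro h
      have h1 : ((fun _ _ => z + 1, 0) : (Fin m → Fin k → ℂ) × (Fin m → Fin l → ℂ)) ∈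
        (⊤ : AffineSubspace ℝ ((Fin m → Fin k → ℂ) × (Fin m → Fin l → ℂ))) := trivial
      rw [← h] at h1
      simp [AffineSubspace.mem_comap, AffineSubspace.mem_mk'] at h1)
  refine measure_mono_null ?_ h
  intro ED hED
  simp only [Set.mem_ofPred_eq] at hED
  simp [AffineSubspace.mem_comap, AffineSubspace.mem_mk', hED]

lemma aux_key {m k l : ℕ} (a : Fin k → ℂ) (b : Fin l → ℂ) (A : (Fin m → ℂ) → Fin k → ℂ)
    (B : (Fin m → ℂ) → Fin l → ℂ) (hA : Differentiable ℝ A) (hB : Differentiable ℝ B)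
    (p : Fin m → Fin k) (j : Fin m) :
    (volume : Measure ((Fin m → Fin k → ℂ) × (Fin m → Fin l → ℂ)))
      {ED | ∃ x : Fin m → ℂ, x j = 1 ∧ ∀ i, cc a b A B x (ED.2 i) (p i) ≠ 0 ∧
        ∑ q, ED.1 i q * cc a b A B x (ED.2 i) q = 0} = 0 := by
  classical
  set X : ((Fin m → Fin k → ℂ) × (Fin m → Fin l → ℂ)) → Fin m → ℂ := fun ED i => ED.1 i (p i)
    with hX
  have hXd : Differentiable ℝ X := by
    rw [hX]; fun_prop
  have hAX : ∀ q, Differentiable ℝ (fun ED => A (X ED) q) := fun q =>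
    differentiable_pi.1 (hA.comp hXd) q
  have hBX : ∀ q, Differentiable ℝ (fun ED => B (X ED) q) := fun q =>
    differentiable_pi.1 (hB.comp hXd) q
  have hc : ∀ i q, Differentiable ℝ (fun ED => cc a b A B (X ED) (ED.2 i) q) := by
    intro i q
    unfold cc
    fun_prop
  set s : Set ((Fin m → Fin k → ℂ) × (Fin m → Fin l → ℂ)) :=
    {ED | ED.1 j (p j) = 1 ∧ ∀ i, cc a b A B (X ED) (ED.2 i) (p i) ≠ 0} with hs
  have hs0 : volume s = 0 := measure_mono_null (fun ED h => h.1) (aux_null j (p j) 1)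
  set f : ((Fin m → Fin k → ℂ) × (Fin m → Fin l → ℂ)) →
      ((Fin m → Fin k → ℂ) × (Fin m → Fin l → ℂ)) := fun ED =>
    (fun i q => if q = p i then
      -(∑ q' ∈ Finset.univ.erase (p i), ED.1 i q' * cc a b A B (X ED) (ED.2 i) q') *
        (cc a b A B (X ED) (ED.2 i) (p i))⁻¹
      else ED.1 i q, ED.2) with hf
  have hfd : DifferentiableOn ℝ f s := by
    intro ED hED
    apply DifferentiableAt.differentiableWithinAt
    rw [hf]
    refine DifferentiableAt.prodMk ?_ differentiableAt_snd
    rw [differentiableAt_pi]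
    intro i
    rw [differentiableAt_pi]
    intro q
    by_cases hq : q = p i
    · simp only [hq, if_true]
      refine DifferentiableAt.mul ?_ ((hc i (p i) ED).inv (hED.2 i))
      refine DifferentiableAt.neg ?_
      refine DifferentiableAt.fun_sum fun q' _ => ?_
      refine DifferentiableAt.mul ?_ (hc i q' ED)
      fun_prop
    · simp only [hq, if_false]
      fun_prop
  refine measure_mono_null ?_
    (addHaar_image_eq_zero_of_differentiableOn_of_addHaar_eq_zero volume hfd hs0)
  rintro ⟨E, D⟩ ⟨x, hxj, hx⟩
  have hXx : X (fun i q => if q = p i then x i else E i q, D) = x := by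
    funext i; simp [hX]
  refine ⟨(fun i q => if q = p i then x i else E i q, D), ⟨by simp [hxj], ?_⟩, ?_⟩
  · intro i
    rw [hXx]
    exact (hx i).1
  · simp only [hf, hXx]
    refine Prod.ext ?_ rfl
    funext i q
    by_cases hq : q = p i
    · simp only [hq, if_true]
      obtain ⟨h1, h2⟩ := hx i
      simp only at h1 h2
      rw [← div_eq_mul_inv, div_eq_iff h1, neg_eq_iff_add_eq_zero,
        ← Finset.add_sum_erase _ _ (Finset.mem_univ (p i))] at *
      rw [add_comm] at h2
      rw [← h2]
      congr 1
      refine Finset.sum_congr rfl fun q' hq' => ?_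
      rw [if_neg (Finset.ne_of_mem_erase hq')]
    · simp [hq]

lemma aux_dot1 {m k l : ℕ} (a : Fin k → ℂ) (ha : a ≠ 0) (i : Fin m) :
    ∀ᵐ ED ∂(volume : Measure ((Fin m → Fin k → ℂ) × (Fin m → Fin l → ℂ))),
      (∑ q, ED.1 i q * a q) ≠ 0 := by
  obtain ⟨r, hr⟩ := Function.ne_iff.1 ha
  let φ : ((Fin m → Fin k → ℂ) × (Fin m → Fin l → ℂ)) →ₗ[ℝ] ℂ :=
    { toFun := fun ED => ∑ q, ED.1 i q * a q
      map_add' := by intro x y; simp [add_mul, Finset.sum_add_distrib]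
      map_smul' := by intro c x; simp [Finset.mul_sum, mul_assoc] }
  have h := Measure.addHaar_submodule
    (volume : Measure ((Fin m → Fin k → ℂ) × (Fin m → Fin l → ℂ))) (LinearMap.ker φ) (by
      intro h
      rw [LinearMap.ker_eq_top] at h
      have := LinearMap.congr_fun h (fun _ => Pi.single r 1, 0)
      simp [φ, Pi.single_apply] at this
      exact hr this)
  rw [ae_iff]
  refine measure_mono_null ?_ h
  intro ED hED
  simpa [φ] using hED

lemma aux_dot2 {m k l : ℕ} (b : Fin l → ℂ) (hb : b ≠ 0) (i : Fin m) :
    ∀ᵐ ED ∂(volume : Measure ((Fin m → Fin k → ℂ) × (Fin m → Fin l → ℂ))),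
      (∑ q, ED.2 i q * b q) ≠ 0 := by
  obtain ⟨r, hr⟩ := Function.ne_iff.1 hb
  let φ : ((Fin m → Fin k → ℂ) × (Fin m → Fin l → ℂ)) →ₗ[ℝ] ℂ :=
    { toFun := fun ED => ∑ q, ED.2 i q * b q
      map_add' := by intro x y; simp [add_mul, Finset.sum_add_distrib]
      map_smul' := by intro c x; simp [Finset.mul_sum, mul_assoc] }
  have h := Measure.addHaar_submodule
    (volume : Measure ((Fin m → Fin k → ℂ) × (Fin m → Fin l → ℂ))) (LinearMap.ker φ) (by
      intro h
      rw [LinearMap.ker_eq_top] at h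
      have := LinearMap.congr_fun h (0, fun _ => Pi.single r 1)
      simp [φ, Pi.single_apply] at this
      exact hr this)
  rw [ae_iff]
  refine measure_mono_null ?_ h
  intro ED hED
  simpa [φ] using hED

def Good {m k l : ℕ} (s₁ s₂ : ℕ) (a : Fin k → ℂ) (b : Fin l → ℂ)
    (ED : (Fin m → Fin k → ℂ) × (Fin m → Fin l → ℂ)) : Prop :=
  (∀ i, (∑ q, ED.1 i q * a q) ≠ 0) ∧ (∀ i, (∑ q, ED.2 i q * b q) ≠ 0) ∧
  ∀ (a' : Fin k → ℂ) (b' : Fin l → ℂ), Sparse s₁ a' → Sparse s₂ b' → a' ≠ 0 →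
    (∀ i, (∑ q, ED.1 i q * a' q) * (∑ q, ED.2 i q * b' q) =
      (∑ q, ED.1 i q * a q) * (∑ q, ED.2 i q * b q)) →
    ∃ t : ℂ, t ≠ 0 ∧ a' = t • a ∧ ∀ i, (∑ q, ED.2 i q * b' q) = t⁻¹ * (∑ q, ED.2 i q * b q)

lemma aux_opt {m k : ℕ} (g : Fin k → Option (Fin m)) :
    Differentiable ℝ (fun (x : Fin m → ℂ) (q : Fin k) => (g q).elim 0 x) := by
  rw [differentiable_pi]
  intro q
  rcases g q with _ | j
  · simp
  · simp only [Option.elim]; fun_prop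

lemma aux_sparse_smul {k s : ℕ} (a : Fin k → ℂ) (h : Sparse s a) (t : ℂ) : Sparse s (t • a) := by
  unfold Sparse at *
  refine le_trans (Set.ncard_le_ncard ?_ (Set.toFinite _)) h
  intro i hi h0
  exact hi (by simp [h0])

lemma aux_good {m k l s₁ s₂ : ℕ} (hm : s₁ + s₂ ≤ m) (a : Fin k → ℂ) (b : Fin l → ℂ)
    (ha : a ≠ 0) (hb : b ≠ 0) (hm0 : 0 < m) :
    ∀ᵐ ED ∂(volume : Measure ((Fin m → Fin k → ℂ) × (Fin m → Fin l → ℂ))),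
      Good s₁ s₂ a b ED := by
  have h3 : ∀ᵐ ED ∂(volume : Measure ((Fin m → Fin k → ℂ) × (Fin m → Fin l → ℂ))),
      ∀ (g : Fin k → Option (Fin m)) (h : Fin l → Option (Fin m)) (p : Fin m → Fin k) (j : Fin m),
      ¬ ∃ x : Fin m → ℂ, x j = 1 ∧ ∀ i,
        cc a b (fun x q => (g q).elim 0 x) (fun x q => (h q).elim 0 x) x (ED.2 i) (p i) ≠ 0 ∧
        ∑ q, ED.1 i q *
          cc a b (fun x q => (g q).elim 0 x) (fun x q => (h q).elim 0 x) x (ED.2 i) q = 0 := by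
    rw [ae_all_iff]; intro g
    rw [ae_all_iff]; intro h
    rw [ae_all_iff]; intro p
    rw [ae_all_iff]; intro j
    rw [ae_iff]
    simp only [not_not]
    exact aux_key a b _ _ (aux_opt g) (aux_opt h) p j
  filter_upwards [ae_all_iff.2 (fun i => aux_dot1 (m := m) (l := l) a ha i),
    ae_all_iff.2 (fun i => aux_dot2 (m := m) (k := k) b hb i), h3] with ED h1 h2 h3
  refine ⟨h1, h2, ?_⟩
  intro a' b' ha' hb' ha0 heq
  have hz : ∃ i, ∀ q, a q * (∑ r, ED.2 i r * b r) - a' q * (∑ r, ED.2 i r * b' r) = 0 := by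
    by_contra hcon
    push Not at hcon
    choose p hp using hcon
    obtain ⟨q0, hq0⟩ := Function.ne_iff.1 ha0
    simp only [Pi.zero_apply] at hq0
    obtain ⟨g, h, j, x, hxj, hg, hh⟩ := aux_encode hm ((a' q0)⁻¹ • a') (a' q0 • b')
      (aux_sparse_smul _ ha' _) (aux_sparse_smul _ hb' _) q0 (by simp [hq0])
    have hcc : ∀ i q, cc a b (fun x q => (g q).elim 0 x) (fun x q => (h q).elim 0 x) x (ED.2 i) q
        = a q * (∑ r, ED.2 i r * b r) - a' q * (∑ r, ED.2 i r * b' r) := by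
      intro i q
      unfold cc
      have e1 := congrFun hg q
      have e2 : ∀ r, (h r).elim 0 x = a' q0 * b' r := fun r => (congrFun hh r).symm
      simp only [Pi.smul_apply, smul_eq_mul] at e1
      simp only [e2, ← e1]
      have : ∑ r, ED.2 i r * (a' q0 * b' r) = a' q0 * ∑ r, ED.2 i r * b' r := by
        rw [Finset.mul_sum]; exact Finset.sum_congr rfl fun r _ => by ring
      rw [this]
      field_simp
    refine h3 g h p j ⟨x, hxj, fun i => ⟨by rw [hcc]; exact hp i, ?_⟩⟩
    simp only [hcc]
    have := heq i
    calc _ = (∑ q, ED.1 i q * a q) * (∑ q, ED.2 i q * b q) -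
        (∑ q, ED.1 i q * a' q) * (∑ q, ED.2 i q * b' q) := by
          rw [Finset.sum_mul, Finset.sum_mul _ _ (∑ q, ED.2 i q * b' q), ← Finset.sum_sub_distrib]
          exact Finset.sum_congr rfl fun q _ => by ring
      _ = 0 := by rw [this, sub_self]
  obtain ⟨i, hi⟩ := hz
  obtain ⟨q, hq⟩ := Function.ne_iff.1 ha
  have hy : (∑ r, ED.2 i r * b' r) ≠ 0 := by
    intro h0
    have := hi q
    rw [h0, mul_zero, sub_zero] at this
    exact (mul_ne_zero hq (h2 i)) this
  set t := (∑ r, ED.2 i r * b r) / (∑ r, ED.2 i r * b' r) with ht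
  have ht0 : t ≠ 0 := div_ne_zero (h2 i) hy
  have hat : a' = t • a := by
    funext q
    have := hi q
    simp only [Pi.smul_apply, smul_eq_mul, ht]
    field_simp
    linear_combination -this
  refine ⟨t, ht0, hat, fun i => ?_⟩
  have := heq i
  have e : ∑ q, ED.1 i q * a' q = t * ∑ q, ED.1 i q * a q := by
    rw [hat, Finset.mul_sum]
    exact Finset.sum_congr rfl fun q _ => by simp; ring
  rw [e] at this
  have h4 : (∑ q, ED.1 i q * a q) * (t * (∑ q, ED.2 i q * b' q) - (∑ q, ED.2 i q * b q)) = 0 := by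
    linear_combination this
  have h5 := (mul_eq_zero.1 h4).resolve_left (h1 i)
  field_simp
  linear_combination h5

/-- the discrete Fourier transform on `Fin (n+1)` -/
def FT (n : ℕ) (V : Type) [AddCommGroup V] [Module ℂ V] :
    (Fin (n + 1) → V) ≃ₗ[ℂ] (Fin (n + 1) → V) :=
  (ZMod.dft : (ZMod (n + 1) → V) ≃ₗ[ℂ] (ZMod (n + 1) → V))

/-- the standard additive character on `Fin (n+1)` -/
def ch (n : ℕ) (j : Fin (n + 1)) : ℂ := ZMod.stdAddChar (N := n + 1) j

lemma ch_zero (n : ℕ) : ch n 0 = 1 := AddChar.map_zero_eq_one (ZMod.stdAddChar (N := n + 1))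

lemma ch_add (n : ℕ) (i j : Fin (n + 1)) : ch n (i + j) = ch n i * ch n j :=
  AddChar.map_add_eq_mul (ZMod.stdAddChar (N := n + 1)) i j

lemma ch_ne (n : ℕ) (i : Fin (n + 1)) : ch n i ≠ 0 := by
  intro h
  have := ch_add n i (-i)
  rw [add_neg_cancel, ch_zero, h, zero_mul] at this
  exact one_ne_zero this

lemma FT_apply (n : ℕ) (V : Type) [AddCommGroup V] [Module ℂ V] (f : Fin (n + 1) → V)
    (r : Fin (n + 1)) :
    FT n V f r = ∑ j : Fin (n + 1), ch n (-(j * r)) • f j :=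
  ZMod.dft_apply (N := n + 1) f r

lemma FT_mul {n k : ℕ} (E : Fin (n + 1) → Fin k → ℂ) (a : Fin k → ℂ) (r : Fin (n + 1)) :
    FT n ℂ (Matrix.of E *ᵥ a) r = ∑ q, FT n (Fin k → ℂ) E r q * a q := by
  simp only [FT_apply, Finset.sum_apply, Matrix.mulVec, dotProduct,
    Finset.sum_mul, Pi.smul_apply, smul_eq_mul, Matrix.of_apply]
  rw [Finset.sum_comm]
  refine Finset.sum_congr rfl fun q _ => ?_
  rw [Finset.mul_sum]
  exact Finset.sum_congr rfl fun j _ => by ring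

lemma aux_idx (n : ℕ) (i j : Fin (n + 1)) :
    (⟨(n + 1 + i.val - j.val - 1) % (n + 1), Nat.mod_lt _ i.pos⟩ : Fin (n + 1)) = i - j - 1 := by
  have key : (⟨(n + 1 + i.val - j.val - 1) % (n + 1), Nat.mod_lt _ i.pos⟩ : Fin (n + 1)) + 1 + j
      = i := by
    apply Fin.ext
    rw [Fin.val_add, Fin.val_add, Fin.val_one']
    simp only [Nat.add_mod_mod, Nat.mod_add_mod]
    have hj := j.isLt
    have : n + 1 + i.val - j.val - 1 + 1 + j.val = i.val + (n + 1) := by omega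
    rw [this, Nat.add_mod_right, Nat.mod_eq_of_lt i.isLt]
  rw [eq_sub_iff_add_eq, eq_sub_iff_add_eq, key]

lemma FT_conv {n : ℕ} (v w : Fin (n + 1) → ℂ) (r : Fin (n + 1)) :
    FT n ℂ (circConv (n + 1) v w) r = ch n (-r) * (FT n ℂ v r * FT n ℂ w r) := by
  have e2 : ∀ i j : Fin (n + 1), ch n (-((i + (j + 1)) * r)) =
      ch n (-r) * (ch n (-(j * r)) * ch n (-(i * r))) := by
    intro i j
    rw [← ch_add, ← ch_add]
    congr 1
    have key : ∀ i j r : ZMod (n + 1), -((i + (j + 1)) * r) = -r + (-(j * r) + -(i * r)) := by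
      intro i j r; ring
    exact key i j r
  simp only [FT_apply, circConv, aux_idx, smul_eq_mul]
  rw [Finset.sum_mul_sum, Finset.mul_sum]
  simp only [Finset.mul_sum]
  rw [Finset.sum_comm]
  refine Finset.sum_congr rfl fun j _ => ?_
  rw [← Equiv.sum_comp (Equiv.addRight (j + 1))]
  refine Finset.sum_congr rfl fun i _ => ?_
  have e1 : i + (j + 1) - j - 1 = i := by abel
  simp only [Equiv.coe_addRight]
  rw [e1, e2]
  ring

theorem stmt8 (m k l s₁ s₂ : ℕ) (hs₁ : 1 ≤ s₁) (hs₂ : 1 ≤ s₂) (hm : s₁ + s₂ ≤ m)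
    (hk : s₁ ≤ k) (hkm : k ≤ m) (hl : s₂ ≤ l) (hlm : l ≤ m)
    (a : Fin k → ℂ) (b : Fin l → ℂ) (ha : a ≠ 0) (has : Sparse s₁ a)
    (hb : b ≠ 0) (hbs : Sparse s₂ b) :
    ∀ᵐ ED ∂(volume : Measure ((Fin m → Fin k → ℂ) × (Fin m → Fin l → ℂ))),
      Matrix.of ED.1 *ᵥ a ≠ 0 ∧ Matrix.of ED.2 *ᵥ b ≠ 0 ∧
      WeakIdentAt
        {q : (Fin m → ℂ) × (Fin m → ℂ) |
          (∃ a' : Fin k → ℂ, Sparse s₁ a' ∧ q.1 = Matrix.of ED.1 *ᵥ a') ∧ q.1 ≠ 0 ∧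
          (∃ b' : Fin l → ℂ, Sparse s₂ b' ∧ q.2 = Matrix.of ED.2 *ᵥ b') ∧ q.2 ≠ 0}
        (circConv m) (Matrix.of ED.1 *ᵥ a, Matrix.of ED.2 *ᵥ b) := by

  obtain ⟨n, rfl⟩ : ∃ n, m = n + 1 := ⟨m - 1, by omega⟩
  have hgood := aux_good (s₁ := s₁) (s₂ := s₂) hm a b ha hb (Nat.succ_pos n)
  let L : ((Fin (n + 1) → Fin k → ℂ) × (Fin (n + 1) → Fin l → ℂ)) ≃L[ℝ]
      ((Fin (n + 1) → Fin k → ℂ) × (Fin (n + 1) → Fin l → ℂ)) :=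
    (((FT n (Fin k → ℂ)).prodCongr (FT n (Fin l → ℂ))).restrictScalars ℝ).toContinuousLinearEquiv
  have hL : ∀ᵐ ED ∂(volume : Measure ((Fin (n + 1) → Fin k → ℂ) × (Fin (n + 1) → Fin l → ℂ))),
      Good s₁ s₂ a b (FT n (Fin k → ℂ) ED.1, FT n (Fin l → ℂ) ED.2) := by
    rw [ae_iff] at hgood ⊢
    have := Measure.addHaar_preimage_continuousLinearEquiv
      (volume : Measure ((Fin (n + 1) → Fin k → ℂ) × (Fin (n + 1) → Fin l → ℂ))) L
      {ED | ¬ Good s₁ s₂ a b ED}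
    rw [hgood, mul_zero] at this
    exact this
  filter_upwards [hL] with ED hG
  obtain ⟨h1, h2, h3⟩ := hG
  simp only [← FT_mul] at h1 h2 h3
  refine ⟨fun h => h1 0 (by rw [h]; simp), fun h => h2 0 (by rw [h]; simp), ?_⟩
  rintro ⟨v, w⟩ ⟨⟨a', ha', hv⟩, hv0, ⟨b', hb', hw⟩, -⟩ heq
  simp only at hv hw hv0 heq
  subst hv hw
  obtain ⟨t, ht, hat, hbt⟩ := h3 a' b' ha' hb' (by rintro rfl; simp at hv0) (by
    intro i
    have := congrFun (congrArg (FT n ℂ) heq) i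
    rw [FT_conv, FT_conv] at this
    exact mul_left_cancel₀ (ch_ne n _) this)
  refine ⟨t, ht, by simp only [hat, Matrix.mulVec_smul], ?_⟩
  apply (FT n ℂ).injective
  funext i
  rw [map_smul]
  exact hbt i
end
end
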